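/- Let k be a perfect field of characteristic p, W = W(k), 𝔖 = W[[x_1,…,x_r]], J ⊆ 𝔖 the ideal generated by the variables, and E′ ∈ 𝔖 with E′ ∈ J^e and E′ ∉ J^{e+1} + p·𝔖. Then for every n ≥ 1 the quotient 𝔖/(E′·𝔖 + J^n) is a free W-module of finite rank. -/

import Mathlib

namespace MvPowerSeries

variable {σ R : Type*} [CommRing R]

theorem coe_le_order_iff {n : ℕ} {f : MvPowerSeries σ R} :
    (n : ℕ∞) ≤ f.order ↔ ∀ d : σ →₀ ℕ, d.degree < n → coeff d f = 0 :=
  ⟨fun h _ hd => coeff_of_lt_order (lt_of_lt_of_le (Nat.cast_lt.mpr hd) h), nat_le_order⟩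

theorem le_order_of_mem_span_X_pow {n : ℕ} {f : MvPowerSeries σ R}
    (hf : f ∈ Ideal.span (Set.range (X : σ → MvPowerSeries σ R)) ^ n) : (n : ℕ∞) ≤ f.order := by
  induction n generalizing f with
  | zero => simp
  | succ n ih =>
    rw [pow_succ] at hf
    induction hf using Submodule.mul_induction_on' with
    | mem_mul_mem a ha b hb =>
      have hb' : (1 : ℕ∞) ≤ b.order := by
        rw [one_le_order_iff_constCoeff_eq_zero]
        have : Ideal.span (Set.range (X : σ → MvPowerSeries σ R)) ≤
            RingHom.ker (constantCoeff (σ := σ) (R := R)) := by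
          rw [Ideal.span_le]
          rintro _ ⟨i, rfl⟩
          simp
        exact this hb
      push_cast
      exact (add_le_add (ih ha) hb').trans le_order_mul
    | add a _ b _ ha hb => exact (le_min ha hb).trans min_order_le_add

theorem exists_eq_sum_X_mul [Fintype σ] {n : ℕ} {f : MvPowerSeries σ R}
    (hf : ((n + 1 : ℕ) : ℕ∞) ≤ f.order) :
    ∃ g : σ → MvPowerSeries σ R, (∀ i, (n : ℕ∞) ≤ (g i).order) ∧ f = ∑ i, X i * g i := by
  classical
  rw [coe_le_order_iff] at hf
  have hex (m : σ →₀ ℕ) (hm : m ≠ 0) : ∃ i, m i ≠ 0 := by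
    simpa using DFunLike.ne_iff.mp hm
  choose c hc using hex
  let g (i : σ) : MvPowerSeries σ R := fun d =>
    if c (d + Finsupp.single i 1) (by simp) = i then coeff (d + Finsupp.single i 1) f else 0
  have hg (i : σ) (d : σ →₀ ℕ) : coeff d (g i) =
    if c (d + Finsupp.single i 1) (by simp) = i then coeff (d + Finsupp.single i 1) f else 0 := rfl
  refine ⟨g, fun i => coe_le_order_iff.mpr fun d hd => ?_, ?_⟩
  · rw [hg, hf _ (by simpa using hd), ite_self]
  · ext m
    rw [map_sum]
    by_cases hm : m = 0
    · subst hm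
      rw [hf 0 (by simp)]
      simp
    have key (i : σ) : coeff m (X i * g i) = if c m hm = i then coeff m f else 0 := by
      by_cases hi : m i = 0
      · have hne : c m hm ≠ i := fun h => hc m hm (h ▸ hi)
        rw [if_neg hne, X_def, coeff_monomial_mul, if_neg]
        intro hle
        simpa [hi] using hle i
      · have hle : Finsupp.single i 1 ≤ m := by
          rw [Finsupp.single_le_iff]; lia
        obtain ⟨d, rfl⟩ := exists_add_of_le hle
        rw [X_def, coeff_add_monomial_mul, one_mul, hg]
        simp only [add_comm]
    simp [key]

theorem mem_span_X_pow_iff [Fintype σ] {n : ℕ} {f : MvPowerSeries σ R} :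
    f ∈ Ideal.span (Set.range (X : σ → MvPowerSeries σ R)) ^ n ↔ (n : ℕ∞) ≤ f.order := by
  refine ⟨le_order_of_mem_span_X_pow, fun hf => ?_⟩
  induction n generalizing f with
  | zero => simp
  | succ n ih =>
    obtain ⟨g, hg, rfl⟩ := exists_eq_sum_X_mul hf
    refine Ideal.sum_mem _ fun i _ => ?_
    rw [pow_succ']
    exact Ideal.mul_mem_mul (Ideal.subset_span ⟨i, rfl⟩) (ih (hg i))

/-- A quotient of `R[[x_1,…,x_r]]` by an ideal containing a power of the ideal of the variables is
a finite `R`-module. -/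
theorem finite_quotient_of_span_X_pow_le [Fintype σ] {n : ℕ} {I : Ideal (MvPowerSeries σ R)}
    (hI : Ideal.span (Set.range (X : σ → MvPowerSeries σ R)) ^ n ≤ I) :
    Module.Finite R (MvPowerSeries σ R ⧸ I) := by
  classical
  let s := (Finsupp.finite_of_degree_lt (σ := σ) n).toFinset
  let φ : (s → R) →ₗ[R] MvPowerSeries σ R :=
    ∑ d : s, (monomial (d : σ →₀ ℕ)).comp (LinearMap.proj d)
  refine Module.Finite.of_surjective ((Ideal.Quotient.mkₐ R I).toLinearMap.comp φ) fun q => ?_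
  obtain ⟨f, rfl⟩ := Ideal.Quotient.mk_surjective q
  refine ⟨fun d => coeff (d : σ →₀ ℕ) f, ?_⟩
  change Ideal.Quotient.mk I (φ fun d => coeff (d : σ →₀ ℕ) f) = _
  rw [Ideal.Quotient.eq]
  refine hI (mem_span_X_pow_iff.mpr (coe_le_order_iff.mpr fun m hm => ?_))
  have hms : m ∈ s := by simpa [s] using hm
  have : φ (fun d => coeff (d : σ →₀ ℕ) f) = ∑ d ∈ s, monomial d (coeff d f) := by
    rw [← Finset.sum_coe_sort]
    simp [φ]
  rw [map_sub, this, map_sum]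
  simp [coeff_monomial, hms]

theorem exists_eq_C_mul {a : R} {f : MvPowerSeries σ R} (hf : ∀ d, a ∣ coeff d f) :
    ∃ g, f = C a * g := by
  choose c hc using hf
  let g : MvPowerSeries σ R := c
  have hg (d) : coeff d g = c d := rfl
  exact ⟨g, ext fun d => by rw [coeff_C_mul, hc d, hg]⟩

end MvPowerSeries

namespace WittVector

theorem p_dvd_of_constantCoeff_eq_zero {p : ℕ} [Fact p.Prime] {k : Type*} [Field k] [CharP k p]
    [PerfectRing k p] {x : WittVector p k} (hx : constantCoeff x = 0) :
    (p : WittVector p k) ∣ x := by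
  by_cases h0 : x = 0
  · simp [h0]
  obtain ⟨m, b, hb, rfl⟩ := exists_eq_pow_p_mul x h0
  rcases m with _ | m
  · exact absurd (by simpa using hx) hb
  · exact Dvd.dvd.mul_right (dvd_pow_self _ m.succ_ne_zero) b

end WittVector

open MvPowerSeries in
theorem MvPowerSeries.exists_eq_p_mul_add {p : ℕ} [Fact p.Prime] {k : Type*} [Field k] [CharP k p]
    [PerfectRing k p] {σ : Type*} {m : ℕ} {f : MvPowerSeries σ (WittVector p k)}
    (hf : (m : ℕ∞) ≤ (map WittVector.constantCoeff f).order) :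
    ∃ g h, f = (p : MvPowerSeries σ (WittVector p k)) * g + h ∧ (m : ℕ∞) ≤ h.order := by
  classical
  let l : MvPowerSeries σ (WittVector p k) := fun d => if d.degree < m then coeff d f else 0
  have hl (d) : coeff d l = if d.degree < m then coeff d f else 0 := rfl
  obtain ⟨g, hg⟩ := exists_eq_C_mul (a := (p : WittVector p k)) (f := l) fun d => by
    rw [hl]
    split_ifs with hd
    · exact WittVector.p_dvd_of_constantCoeff_eq_zero
        (by simpa [coeff_map] using coe_le_order_iff.mp hf d hd)
    · exact dvd_zero _
  refine ⟨g, f - l, ?_, coe_le_order_iff.mpr fun d hd => by simp [hl, hd]⟩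
  rw [map_natCast] at hg
  rw [← hg]
  ring

open MvPowerSeries in
/-- If `E` has the same order `e` as its reduction modulo `p`, then `p` is a nonzerodivisor on
`𝔖 / (E𝔖 + J^n)`. -/
theorem MvPowerSeries.mem_of_p_mul_mem {p : ℕ} [Fact p.Prime] {k : Type*} [Field k] [CharP k p]
    [PerfectRing k p] {σ : Type*} [Fintype σ] {e n : ℕ} {E : MvPowerSeries σ (WittVector p k)}
    (hE : (e : ℕ∞) ≤ E.order) (hE' : (map WittVector.constantCoeff E).order ≤ e)
    {f : MvPowerSeries σ (WittVector p k)}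
    (hf : (p : MvPowerSeries σ (WittVector p k)) * f ∈
      Ideal.span {E} ⊔ Ideal.span (Set.range (X : σ → MvPowerSeries σ (WittVector p k))) ^ n) :
    f ∈ Ideal.span {E} ⊔
      Ideal.span (Set.range (X : σ → MvPowerSeries σ (WittVector p k))) ^ n := by
  obtain ⟨a, ha, j, hj, haj⟩ := Submodule.mem_sup.mp hf
  obtain ⟨g, rfl⟩ := Ideal.mem_span_singleton.mp ha
  have hred : (n : ℕ∞) ≤ (map WittVector.constantCoeff (E * g)).order := by
    have h0 : map WittVector.constantCoeff (E * g) = -map WittVector.constantCoeff j := by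
      rw [eq_neg_iff_add_eq_zero, ← map_add, haj, map_mul, map_natCast,
        ← map_natCast (C (σ := σ) (R := k)), CharP.cast_eq_zero, map_zero, zero_mul]
    rw [h0, order_neg]
    exact (mem_span_X_pow_iff.mp hj).trans (le_order_map _)
  rw [map_mul, order_mul] at hred
  have hg : ((n - e : ℕ) : ℕ∞) ≤ (map WittVector.constantCoeff g).order := by
    rw [ENat.natCast_sub, tsub_le_iff_left]
    exact hred.trans (by gcongr)
  obtain ⟨u, h, rfl, hh⟩ := MvPowerSeries.exists_eq_p_mul_add hg
  have hEh : (n : ℕ∞) ≤ (E * h).order := by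
    refine le_trans ?_ ((add_le_add hE hh).trans le_order_mul)
    exact_mod_cast (by lia : n ≤ e + (n - e))
  have hp : (p : WittVector p k) ≠ 0 := (WittVector.irreducible p).ne_zero
  have hsub : f - E * u ∈
      Ideal.span (Set.range (X : σ → MvPowerSeries σ (WittVector p k))) ^ n := by
    have hmem : (p : MvPowerSeries σ (WittVector p k)) * (f - E * u) ∈
        Ideal.span (Set.range (X : σ → MvPowerSeries σ (WittVector p k))) ^ n := by
      have : (p : MvPowerSeries σ (WittVector p k)) * (f - E * u) = E * h + j := by
        linear_combination -haj
      rw [this]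
      exact add_mem (mem_span_X_pow_iff.mpr hEh) hj
    rw [mem_span_X_pow_iff, coe_le_order_iff] at hmem ⊢
    intro d hd
    have := hmem d hd
    rw [← map_natCast (C (σ := σ) (R := WittVector p k)), coeff_C_mul] at this
    exact (mul_eq_zero.mp this).resolve_left hp
  rw [← add_sub_cancel (E * u) f]
  exact add_mem (Ideal.mem_sup_left (Ideal.mul_mem_right _ _ (Ideal.mem_span_singleton_self E)))
    (Ideal.mem_sup_right hsub)

theorem WittVector.isTorsionFree_of_p_smul {p : ℕ} [Fact p.Prime] {k : Type*} [Field k]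
    [CharP k p] [PerfectRing k p] {M : Type*} [AddCommGroup M] [Module (WittVector p k) M]
    (h : ∀ x : M, (p : WittVector p k) • x = 0 → x = 0) :
    Module.IsTorsionFree (WittVector p k) M := by
  refine Module.IsTorsionFree.of_smul_eq_zero fun a x hax => ?_
  by_cases ha : a = 0
  · exact Or.inl ha
  obtain ⟨m, b, rfl⟩ := exists_eq_pow_p_mul' a ha
  refine Or.inr ?_
  have hpow (m : ℕ) (y : M) (hy : (p : WittVector p k) ^ m • y = 0) : y = 0 := by
    induction m with
    | zero => simpa using hy
    | succ m ih => exact ih (h _ (by rwa [smul_smul, ← pow_succ']))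
  have := hpow m _ (by rwa [smul_smul])
  exact (b.isUnit.smul_eq_zero).mp this


/-- With `𝔖 = W(k)[[x_1,…,x_r]]`, `J` the ideal of the
variables, and `E′ ∈ J^e`, `E′ ∉ J^{e+1} + p𝔖`: for every `n ≥ 1` the
quotient `𝔖/(E′𝔖 + J^n)` is a free `W(k)`-module of finite rank. -/
theorem quotient_free_finite_rank (p : ℕ) [Fact p.Prime]
    (k : Type*) [Field k] [CharP k p]
    (hk : Function.Bijective fun x : k => x ^ p)
    (r e : ℕ) (E' : MvPowerSeries (Fin r) (WittVector p k))
    (hE'mem : E' ∈ (Ideal.span (Set.range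
      (MvPowerSeries.X : Fin r → MvPowerSeries (Fin r) (WittVector p k)))) ^ e)
    (hE'notmem : E' ∉ (Ideal.span (Set.range
      (MvPowerSeries.X : Fin r → MvPowerSeries (Fin r) (WittVector p k)))) ^ (e + 1) ⊔
      Ideal.span {(p : MvPowerSeries (Fin r) (WittVector p k))})
    (n : ℕ) (hn : 1 ≤ n) :
    Module.Free (WittVector p k)
      (MvPowerSeries (Fin r) (WittVector p k) ⧸
        (Ideal.span {E'} ⊔ (Ideal.span (Set.range
          (MvPowerSeries.X : Fin r → MvPowerSeries (Fin r) (WittVector p k)))) ^ n)) ∧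
    Module.Finite (WittVector p k)
      (MvPowerSeries (Fin r) (WittVector p k) ⧸
        (Ideal.span {E'} ⊔ (Ideal.span (Set.range
          (MvPowerSeries.X : Fin r → MvPowerSeries (Fin r) (WittVector p k)))) ^ n)) := by
  have : PerfectRing k p := ⟨hk⟩
  have hfin := MvPowerSeries.finite_quotient_of_span_X_pow_le (n := n)
    (le_sup_right (a := Ideal.span {E'}) (b := (Ideal.span (Set.range
      (MvPowerSeries.X : Fin r → MvPowerSeries (Fin r) (WittVector p k)))) ^ n))
  have hred : (MvPowerSeries.map WittVector.constantCoeff E').order ≤ e := by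
    by_contra! hlt
    obtain ⟨g, h, hgh, hh⟩ := MvPowerSeries.exists_eq_p_mul_add (m := e + 1)
      (by exact_mod_cast Order.add_one_le_of_lt hlt)
    refine hE'notmem ?_
    rw [hgh]
    exact add_mem (Ideal.mem_sup_right
      (Ideal.mul_mem_right _ _ (Ideal.mem_span_singleton_self _)))
      (Ideal.mem_sup_left (MvPowerSeries.mem_span_X_pow_iff.mpr hh))
  have htf := WittVector.isTorsionFree_of_p_smul (p := p) (k := k)
    (M := MvPowerSeries (Fin r) (WittVector p k) ⧸
      (Ideal.span {E'} ⊔ (Ideal.span (Set.range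
        (MvPowerSeries.X : Fin r → MvPowerSeries (Fin r) (WittVector p k)))) ^ n)) fun x hx => by
    obtain ⟨f, rfl⟩ := Ideal.Quotient.mk_surjective x
    rw [Nat.cast_smul_eq_nsmul, ← map_nsmul, Ideal.Quotient.eq_zero_iff_mem, nsmul_eq_mul] at hx
    exact Ideal.Quotient.eq_zero_iff_mem.mpr (MvPowerSeries.mem_of_p_mul_mem
      (MvPowerSeries.mem_span_X_pow_iff.mp hE'mem) hred hx)
  exact ⟨Module.free_iff_isTorsionFree.mpr htf, hfin⟩
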